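/- Let (G=(V,E), u, c, k) be a Cap-k-ECSS instance with capacities u_e ∈ {1,…,k}, let u_max = max_{e∈E} u_e, and let r ∈ V. Let F* ⊆ E be any feasible solution, and let D* be the directed multigraph obtained from (V,F*) by replacing every edge xy ∈ F* by u_{xy} bidirected pairs of arcs (x,y),(y,x), each arc arising from an edge e having cost c_e. Then D* contains an r-rooted k-arborescence of cost at most min(k, 2·u_max)·c(F*). -/

import Mathlib

/-!
Cap-k-ECSS: for any feasible solution `F*`, the digraph `D*` obtained from `(V, F*)` by
replacing each edge `e ∈ F*` by `u e` bidirected pairs of arcs contains an `r`-rooted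
`k`-arborescence of cost at most `min(k, 2·u_max) · c(F*)`.

Arcs are modeled by triples `(e, i, b) : E × Fin k × Bool` with copy index `i < u e`
and orientation `b`; the arcs of `D*` are those with `e ∈ F*`.
-/

/-- The set of edges of `F` having exactly one endpoint in `S`, i.e. `F ∩ δ(S)`. -/
def cutEdges {V E : Type*} [DecidableEq V] (ends : E → V × V) (F : Finset E)
    (S : Finset V) : Finset E :=
  F.filter fun e => ¬(((ends e).1 ∈ S) ↔ ((ends e).2 ∈ S))

/-- `F` is feasible for the Cap-k-ECSS instance. -/
def CapFeasible {V E : Type*} [Fintype V] [DecidableEq V] (ends : E → V × V)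
    (u : E → ℕ) (k : ℕ) (F : Finset E) : Prop :=
  ∀ R : Finset V, R.Nonempty → R ≠ Finset.univ → k ≤ ∑ e ∈ cutEdges ends F R, u e

/-- Acyclicity of the underlying undirected multigraph of an arc set. -/
def UndirAcyclic {W A : Type*} [DecidableEq W] (arcs : A → W × W) (T : Finset A) : Prop :=
  ∀ T' ⊆ T, T'.Nonempty →
    T'.card < ((T'.image fun a => (arcs a).1) ∪ (T'.image fun a => (arcs a).2)).card

/-- `T` is an `r`-rooted arborescence. -/
def IsArborescence {W A : Type*} [DecidableEq W] (arcs : A → W × W) (r : W)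
    (T : Finset A) : Prop :=
  UndirAcyclic arcs T ∧
    ∀ v : W, Relation.ReflTransGen (fun x y => ∃ a ∈ T, arcs a = (x, y)) r v

/-- `T` is an `r`-rooted `k`-arborescence: a union of `k` arc-disjoint `r`-rooted
arborescences. -/
def IsKArborescence {W A : Type*} [DecidableEq W] [DecidableEq A] (arcs : A → W × W)
    (r : W) (k : ℕ) (T : Finset A) : Prop :=
  ∃ P : Fin k → Finset A,
    (∀ i, IsArborescence arcs r (P i)) ∧
    (∀ i j, i ≠ j → Disjoint (P i) (P j)) ∧
    Finset.univ.biUnion P = T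

/-- The arc `(e, i, b)` arising from edge `e`: `b` chooses the orientation. -/
def capArcEnds {V E : Type*} (ends : E → V × V) (k : ℕ) (a : E × Fin k × Bool) :
    V × V :=
  if a.2.2 then ends a.1 else ((ends a.1).2, (ends a.1).1)

/-- Number of arcs of `A` entering `S`. -/
def inDeg {W A : Type*} [DecidableEq W] (arcs : A → W × W) (B : Finset A) (S : Finset W) : ℕ :=
  (B.filter fun a => (arcs a).1 ∉ S ∧ (arcs a).2 ∈ S).card

theorem inDeg_submod {W A : Type*} [DecidableEq W] (arcs : A → W × W) (B : Finset A)
    (X Y : Finset W) :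
    inDeg arcs B (X ∩ Y) + inDeg arcs B (X ∪ Y) ≤ inDeg arcs B X + inDeg arcs B Y := by
  simp only [inDeg, Finset.card_filter, ← Finset.sum_add_distrib]
  apply Finset.sum_le_sum
  intro a _
  by_cases h1 : (arcs a).1 ∈ X <;> by_cases h2 : (arcs a).1 ∈ Y <;>
  by_cases h3 : (arcs a).2 ∈ X <;> by_cases h4 : (arcs a).2 ∈ Y <;> simp [h1, h2, h3, h4]

/-- State of the growing arborescence in the proof of Lovasz. -/
structure Partial {W A : Type*} [DecidableEq W] [DecidableEq A] (arcs : A → W × W)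
    (r : W) (k : ℕ) (B : Finset A) (U : Finset W) (T : Finset A) : Prop where
  root : r ∈ U
  sub : T ⊆ B
  inU : ∀ a ∈ T, (arcs a).1 ∈ U ∧ (arcs a).2 ∈ U
  reach : ∀ v ∈ U, Relation.ReflTransGen (fun x y => ∃ a ∈ T, arcs a = (x, y)) r v
  acyc : UndirAcyclic arcs T
  cut : ∀ S : Finset W, S.Nonempty → r ∉ S → k ≤ inDeg arcs (B \ T) S

theorem undirAcyclic_insert {W A : Type*} [DecidableEq W] [DecidableEq A] (arcs : A → W × W)
    (U : Finset W) (T : Finset A) (hT : UndirAcyclic arcs T)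
    (hU : ∀ a ∈ T, (arcs a).1 ∈ U ∧ (arcs a).2 ∈ U) (a : A) (h1 : (arcs a).1 ∈ U)
    (h2 : (arcs a).2 ∉ U) : UndirAcyclic arcs (insert a T) := by
  intro T' hT' hne
  by_cases ha : a ∈ T'
  · have hsub : T'.erase a ⊆ T := by
      intro b hb
      have := hT' (Finset.mem_of_mem_erase hb)
      rcases Finset.mem_insert.1 this with h | h
      · exact absurd h (Finset.ne_of_mem_erase hb)
      · exact h
    have hcard := Finset.card_erase_add_one ha
    rcases (T'.erase a).eq_empty_or_nonempty with he | he
    · rw [he] at hcard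
      have : ({(arcs a).1, (arcs a).2} : Finset W) ⊆
          ((T'.image fun a => (arcs a).1) ∪ (T'.image fun a => (arcs a).2)) := by
        intro w hw
        simp only [Finset.mem_insert, Finset.mem_singleton] at hw
        simp only [Finset.mem_union, Finset.mem_image]
        rcases hw with h | h
        · exact Or.inl ⟨a, ha, h.symm⟩
        · exact Or.inr ⟨a, ha, h.symm⟩
      have h3 := Finset.card_le_card this
      rw [Finset.card_pair (fun h => h2 (by rw [← h]; exact h1))] at h3
      simp at hcard
      omega
    · have h3 := hT _ hsub he
      set Z := (((T'.erase a).image fun a => (arcs a).1) ∪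
        ((T'.erase a).image fun a => (arcs a).2)) with hZ
      have hy : (arcs a).2 ∉ Z := by
        intro h
        simp only [hZ, Finset.mem_union, Finset.mem_image] at h
        rcases h with ⟨b, hb, e⟩ | ⟨b, hb, e⟩
        · exact h2 (e ▸ (hU b (hsub hb)).1)
        · exact h2 (e ▸ (hU b (hsub hb)).2)
      have : insert (arcs a).2 Z ⊆
          ((T'.image fun a => (arcs a).1) ∪ (T'.image fun a => (arcs a).2)) := by
        intro w hw
        simp only [hZ, Finset.mem_insert, Finset.mem_union, Finset.mem_image] at hw ⊢
        rcases hw with h | ⟨b, hb, e⟩ | ⟨b, hb, e⟩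
        · exact Or.inr ⟨a, ha, h.symm⟩
        · exact Or.inl ⟨b, Finset.mem_of_mem_erase hb, e⟩
        · exact Or.inr ⟨b, Finset.mem_of_mem_erase hb, e⟩
      have h4 := Finset.card_le_card this
      rw [Finset.card_insert_of_notMem hy] at h4
      omega
  · apply hT T' _ hne
    intro b hb
    rcases Finset.mem_insert.1 (hT' hb) with h | h
    · exact absurd (h ▸ hb) ha
    · exact h

theorem partial_step {W A : Type*} [Fintype W] [DecidableEq W] [DecidableEq A]
    (arcs : A → W × W) (r : W) (k : ℕ) (B : Finset A) (U : Finset W) (T : Finset A)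
    (hB : ∀ S : Finset W, S.Nonempty → r ∉ S → k + 1 ≤ inDeg arcs B S)
    (h : Partial arcs r k B U T) (hU : U ≠ Finset.univ) :
    ∃ y T', y ∉ U ∧ Partial arcs r k B (insert y U) T' := by
  classical
  -- the family of candidate sets
  let fam : Finset (Finset W) := Finset.univ.filter fun X =>
    (X \ U).Nonempty ∧ (X = Finset.univ ∨ (r ∉ X ∧ inDeg arcs (B \ T) X = k))
  have hfam : fam.Nonempty := by
    refine ⟨Finset.univ, ?_⟩
    simp only [fam, Finset.mem_filter, Finset.mem_univ, true_and, true_or, and_true]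
    rw [Finset.sdiff_nonempty]
    intro h'
    exact hU (Finset.univ_subset_iff.1 h')
  obtain ⟨X, hX, hmin⟩ := fam.exists_min_image Finset.card hfam
  simp only [fam, Finset.mem_filter, Finset.mem_univ, true_and] at hX hmin
  obtain ⟨hXne, hXt⟩ := hX
  have hle : inDeg arcs (B \ T) X ≤ k := by
    rcases hXt with h' | h'
    · subst h'; simp [inDeg]
    · exact h'.2.le
  have hge : k + 1 ≤ inDeg arcs (B \ T) (X \ U) := by
    refine (hB (X \ U) hXne (by simp [h.root])).trans ?_
    apply Finset.card_le_card
    intro a ha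
    simp only [Finset.mem_filter, Finset.mem_sdiff] at ha ⊢
    exact ⟨⟨ha.1, fun hT => ha.2.2.2 (h.inU a hT).2⟩, ha.2⟩
  obtain ⟨a, ha, haX⟩ : ∃ a ∈ (B \ T).filter
      (fun a => (arcs a).1 ∉ X \ U ∧ (arcs a).2 ∈ X \ U),
      a ∉ (B \ T).filter fun a => (arcs a).1 ∉ X ∧ (arcs a).2 ∈ X := by
    by_contra hcon
    push Not at hcon
    have := Finset.card_le_card hcon
    unfold inDeg at hle hge
    omega
  simp only [Finset.mem_filter, Finset.mem_sdiff] at ha haX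
  obtain ⟨⟨haB, haT⟩, hx, hyX, hyU⟩ := ha
  have hxX : (arcs a).1 ∈ X := by tauto
  have hxU : (arcs a).1 ∈ U := by tauto
  refine ⟨(arcs a).2, insert a T, hyU, ?_, ?_, ?_, ?_, ?_, ?_⟩
  · exact Finset.mem_insert_of_mem h.root
  · exact Finset.insert_subset haB h.sub
  · intro b hb
    rcases Finset.mem_insert.1 hb with rfl | hb
    · exact ⟨Finset.mem_insert_of_mem hxU, Finset.mem_insert_self _ _⟩
    · exact ⟨Finset.mem_insert_of_mem (h.inU b hb).1, Finset.mem_insert_of_mem (h.inU b hb).2⟩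
  · have hr : ∀ v ∈ U, Relation.ReflTransGen
        (fun x y => ∃ b ∈ insert a T, arcs b = (x, y)) r v := by
      intro v hv
      refine Relation.ReflTransGen.mono ?_ _ _ (h.reach v hv)
      rintro p q ⟨b, hb, e⟩
      exact ⟨b, Finset.mem_insert_of_mem hb, e⟩
    intro v hv
    rcases Finset.mem_insert.1 hv with rfl | hv
    · exact (hr _ hxU).tail ⟨a, Finset.mem_insert_self _ _, rfl⟩
    · exact hr v hv
  · exact undirAcyclic_insert arcs U T h.acyc h.inU a hxU hyU
  · intro Y hY hrY
    have hkY := h.cut Y hY hrY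
    have hsd : B \ insert a T = (B \ T).erase a := by
      ext b; simp only [Finset.mem_sdiff, Finset.mem_insert, Finset.mem_erase]; tauto
    by_cases hent : (arcs a).1 ∉ Y ∧ (arcs a).2 ∈ Y
    · have hne : inDeg arcs (B \ T) Y ≠ k := by
        intro htight
        -- the intersection is a smaller candidate
        have hint : r ∉ X ∩ Y := by simp [hrY]
        have hintne : (X ∩ Y).Nonempty := ⟨_, Finset.mem_inter.2 ⟨hyX, hent.2⟩⟩
        have hlt : (X ∩ Y).card < X.card := by
          apply Finset.card_lt_card
          refine ⟨Finset.inter_subset_left, fun hs => hent.1 (Finset.mem_inter.1 (hs hxX)).2⟩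
        have ht : inDeg arcs (B \ T) (X ∩ Y) = k := by
          rcases hXt with rfl | ⟨hrX, hXk⟩
          · simpa using htight
          · have h1 := inDeg_submod arcs (B \ T) X Y
            have h2 := h.cut _ hintne hint
            have h3 := h.cut (X ∪ Y) (hY.mono Finset.subset_union_right) (by simp [hrX, hrY])
            omega
        have := hmin (X ∩ Y) ⟨⟨(arcs a).2, by simp [hyX, hent.2, hyU]⟩, Or.inr ⟨hint, ht⟩⟩
        omega
      have : inDeg arcs (B \ insert a T) Y + 1 = inDeg arcs (B \ T) Y := by
        unfold inDeg
        rw [hsd, Finset.filter_erase, Finset.card_erase_add_one]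
        simp only [Finset.mem_filter, Finset.mem_sdiff]
        exact ⟨⟨haB, haT⟩, hent⟩
      omega
    · have : inDeg arcs (B \ insert a T) Y = inDeg arcs (B \ T) Y := by
        unfold inDeg
        rw [hsd, Finset.filter_erase, Finset.erase_eq_of_notMem]
        simp only [Finset.mem_filter]
        exact fun h' => hent h'.2
      omega

theorem partial_complete {W A : Type*} [Fintype W] [DecidableEq W] [DecidableEq A]
    (arcs : A → W × W) (r : W) (k : ℕ) (B : Finset A)
    (hB : ∀ S : Finset W, S.Nonempty → r ∉ S → k + 1 ≤ inDeg arcs B S) (n : ℕ) :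
    ∀ (U : Finset W) (T : Finset A), Partial arcs r k B U T → Uᶜ.card = n →
      ∃ T', Partial arcs r k B Finset.univ T' := by
  induction n with
  | zero =>
    intro U T h hn
    have : U = Finset.univ := by simpa using hn
    exact ⟨T, this ▸ h⟩
  | succ n ih =>
    intro U T h hn
    have hU : U ≠ Finset.univ := by rintro rfl; simp at hn
    obtain ⟨y, T', hy, h'⟩ := partial_step arcs r k B U T hB h hU
    apply ih _ _ h'
    rw [Finset.compl_insert, Finset.card_erase_of_mem (by simpa using hy)]
    omega

/-- The disjoint arborescences theorem of Edmonds. -/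
theorem edmonds {W A : Type*} [Fintype W] [DecidableEq W] [DecidableEq A]
    (arcs : A → W × W) (r : W) (k : ℕ) : ∀ (B : Finset A)
    (_ : ∀ S : Finset W, S.Nonempty → r ∉ S → k ≤ inDeg arcs B S),
    ∃ P : Fin k → Finset A, (∀ i, IsArborescence arcs r (P i)) ∧
      (∀ i j, i ≠ j → Disjoint (P i) (P j)) ∧ ∀ i, P i ⊆ B := by
  induction k with
  | zero =>
    intro B _
    exact ⟨fun _ => ∅, fun i => i.elim0, fun i => i.elim0, fun i => i.elim0⟩
  | succ k ih =>
    intro B hB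
    have h0 : Partial arcs r k B {r} ∅ := by
      refine ⟨by simp, by simp, by simp, ?_, ?_, ?_⟩
      · intro v hv
        rw [Finset.mem_singleton] at hv
        subst hv
        exact Relation.ReflTransGen.refl
      · intro T' hT' hne
        exact absurd (Finset.subset_empty.1 hT') hne.ne_empty
      · intro S hS hr
        have := hB S hS hr
        simp only [Finset.sdiff_empty]
        omega
    obtain ⟨T, hT⟩ := partial_complete arcs r k B hB _ _ _ h0 rfl
    obtain ⟨P, hP1, hP2, hP3⟩ := ih (B \ T) hT.cut
    have hd : ∀ i, Disjoint T (P i) := fun i =>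
      Finset.disjoint_of_subset_right (hP3 i) Finset.disjoint_sdiff
    refine ⟨Fin.cons T P, ?_, ?_, ?_⟩
    · intro i
      refine Fin.cases ?_ (fun i => ?_) i
      · exact ⟨hT.acyc, fun v => hT.reach v (Finset.mem_univ v)⟩
      · exact hP1 i
    · intro i j
      refine Fin.cases ?_ (fun i => ?_) i <;> refine Fin.cases ?_ (fun j => ?_) j
      · intro h; exact absurd rfl h
      · intro _; exact hd j
      · intro _; exact (hd i).symm
      · intro h; exact hP2 i j (fun e => h (e ▸ rfl))
    · intro i
      refine Fin.cases ?_ (fun i => ?_) i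
      · exact hT.sub
      · exact (hP3 i).trans Finset.sdiff_subset

theorem stmt7 {V E : Type*} [Fintype V] [DecidableEq V] [Fintype E] [DecidableEq E]
    (ends : E → V × V) (hloop : ∀ e : E, (ends e).1 ≠ (ends e).2)
    (u : E → ℕ) (c : E → ℝ) (hc : ∀ e, 0 ≤ c e)
    (k : ℕ) (hk : 1 ≤ k) (hu : ∀ e, 1 ≤ u e ∧ u e ≤ k)
    (umax : ℕ) (humax₁ : ∀ e, u e ≤ umax) (humax₂ : ∃ e, u e = umax)
    (r : V) (Fstar : Finset E) (hFstar : CapFeasible ends u k Fstar) :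
    ∃ T : Finset (E × Fin k × Bool),
      (∀ a ∈ T, a.1 ∈ Fstar ∧ (a.2.1 : ℕ) < u a.1) ∧
      IsKArborescence (capArcEnds ends k) r k T ∧
      ∑ a ∈ T, c a.1 ≤ (min k (2 * umax) : ℕ) * ∑ e ∈ Fstar, c e := by
  classical
  let B : Finset (E × Fin k × Bool) :=
    Finset.univ.filter fun a => a.1 ∈ Fstar ∧ (a.2.1 : ℕ) < u a.1
  have hB : ∀ S : Finset V, S.Nonempty → r ∉ S → k ≤ inDeg (capArcEnds ends k) B S := by
    intro S hS hr
    refine (hFstar S hS (fun h => hr (h ▸ Finset.mem_univ r))).trans ?_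
    have hs : ∑ e ∈ cutEdges ends Fstar S, u e =
        ((cutEdges ends Fstar S).sigma fun e => Finset.range (u e)).card := by
      simp
    rw [hs]
    refine Finset.card_le_card_of_surjOn (fun a => ⟨a.1, (a.2.1 : ℕ)⟩) ?_
    rintro ⟨e, i⟩ he
    simp only [Finset.coe_sigma, Set.mem_sigma_iff, Finset.mem_coe, Finset.mem_range, cutEdges,
      Finset.mem_filter] at he
    obtain ⟨⟨heF, hcut⟩, hi⟩ := he
    refine ⟨(e, ⟨i, hi.trans_le (hu e).2⟩, decide ((ends e).2 ∈ S)), ?_, rfl⟩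
    refine Finset.mem_coe.2 (Finset.mem_filter.2
      ⟨Finset.mem_filter.2 ⟨Finset.mem_univ _, heF, hi⟩, ?_⟩)
    simp only [capArcEnds]
    by_cases h2 : (ends e).2 ∈ S
    · simp only [h2, decide_true, if_true, and_true]; tauto
    · simp [h2]; tauto
  obtain ⟨P, hP1, hP2, hP3⟩ := edmonds (capArcEnds ends k) r k B hB
  have hTB : ∀ a ∈ Finset.univ.biUnion P, a.1 ∈ Fstar ∧ (a.2.1 : ℕ) < u a.1 := by
    intro a ha
    obtain ⟨i, _, hi⟩ := Finset.mem_biUnion.1 ha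
    have := hP3 i hi
    simpa [B] using this
  refine ⟨Finset.univ.biUnion P, hTB, ⟨P, hP1, hP2, rfl⟩, ?_⟩
  set T := Finset.univ.biUnion P with hTdef
  -- an arborescence uses every edge at most once
  have hone : ∀ e i, ((P i).filter fun a => a.1 = e).card ≤ 1 := by
    intro e i
    rw [Finset.card_le_one]
    intro a ha b hb
    simp only [Finset.mem_filter] at ha hb
    by_contra hab
    have h1 := (hP1 i).1 {a, b} (by
      intro x hx
      rcases Finset.mem_insert.1 hx with rfl | hx
      · exact ha.1
      · rw [Finset.mem_singleton.1 hx]; exact hb.1) ⟨a, by simp⟩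
    rw [Finset.card_pair hab] at h1
    have h2 : ((({a, b} : Finset (E × Fin k × Bool)).image fun a => (capArcEnds ends k a).1) ∪
        (({a, b} : Finset (E × Fin k × Bool)).image fun a => (capArcEnds ends k a).2)) ⊆
        {(ends e).1, (ends e).2} := by
      have key : ∀ x : E × Fin k × Bool, x.1 = e →
          (capArcEnds ends k x).1 ∈ ({(ends e).1, (ends e).2} : Finset V) ∧
          (capArcEnds ends k x).2 ∈ ({(ends e).1, (ends e).2} : Finset V) := by
        rintro ⟨x, j, d⟩ rfl
        cases d <;> simp [capArcEnds]
      intro w hw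
      simp only [Finset.mem_union, Finset.mem_image, Finset.mem_insert (a := _) (b := a),
        Finset.mem_singleton] at hw
      rcases hw with ⟨x, rfl | rfl, rfl⟩ | ⟨x, rfl | rfl, rfl⟩
      · exact (key _ ha.2).1
      · exact (key _ hb.2).1
      · exact (key _ ha.2).2
      · exact (key _ hb.2).2
    have h3 := (Finset.card_le_card h2).trans Finset.card_le_two
    omega
  have hfib : ∀ e, (T.filter fun a => a.1 = e).card ≤ min k (2 * umax) := by
    intro e
    refine le_min ?_ ?_
    · rw [hTdef, Finset.filter_biUnion]
      refine (Finset.card_biUnion_le_card_mul _ _ 1 (fun i _ => hone e i)).trans ?_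
      simp
    · have : (T.filter fun a => a.1 = e).card ≤
          (Finset.range umax ×ˢ (Finset.univ : Finset Bool)).card := by
        refine Finset.card_le_card_of_injOn (fun a => ((a.2.1 : ℕ), a.2.2)) ?_ ?_
        · intro a ha
          have ha := Finset.mem_filter.1 ha
          have := (hTB a ha.1).2.trans_le (humax₁ _)
          simpa using this
        · intro a ha b hb hab
          have ha := (Finset.mem_filter.1 ha).2
          have hb := (Finset.mem_filter.1 hb).2
          obtain ⟨a1, a2, a3⟩ := a
          obtain ⟨b1, b2, b3⟩ := b
          simp only [Prod.mk.injEq] at hab ha hb ⊢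
          exact ⟨ha.trans hb.symm, Fin.ext hab.1, hab.2⟩
      simp only [Finset.card_product, Finset.card_range, Finset.card_univ, Fintype.card_bool] at this
      omega
  rw [← Finset.sum_fiberwise_of_maps_to (g := fun a => a.1) (t := Fstar)
    (fun a ha => (hTB a ha).1), Finset.mul_sum]
  apply Finset.sum_le_sum
  intro e _
  have : ∑ a ∈ T.filter (fun a => a.1 = e), c a.1 = ((T.filter fun a => a.1 = e).card : ℝ) * c e := by
    rw [Finset.sum_congr rfl (g := fun _ => c e)
      (fun a ha => by rw [(Finset.mem_filter.1 ha).2])]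
    simp
  rw [this]
  exact mul_le_mul_of_nonneg_right (by exact_mod_cast hfib e) (hc e)
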